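/- arXiv:math/9807083 — 8 statements merged into one kernel-verified Lean document; each statement's English description precedes it below -/
import Mathlib

section
/- Under the projective Lelieuvre relations in asymptotic coordinates, at every point p ∈ ℝ² one has ⟨f_x,ν⟩ = ⟨f,ν_x⟩ = ⟨f_x,ν_x⟩ = ⟨f_{xx},ν⟩ = ⟨f,ν_{xx}⟩ = ⟨f_{xx},ν_{xx}⟩ = 0 and ⟨f_y,ν⟩ = ⟨f,ν_y⟩ = ⟨f_y,ν_y⟩ = ⟨f_{yy},ν⟩ = ⟨f,ν_{yy}⟩ = ⟨f_{yy},ν_{yy}⟩ = 0. -/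
noncomputable section

/-- Euclidean pairing on `ℝ⁴`. -/
def dot4 (a b : Fin 4 → ℝ) : ℝ := ∑ i, a i * b i

/-- Determinant of the 4×4 matrix with rows `a, b, c, d`. -/
def det4 (a b c d : Fin 4 → ℝ) : ℝ := Matrix.det (Matrix.of ![a, b, c, d])

/-- Partial derivative in the first (`x`) variable. -/
def dx (g : ℝ × ℝ → Fin 4 → ℝ) : ℝ × ℝ → Fin 4 → ℝ := fun p => fderiv ℝ g p (1, 0)

/-- Partial derivative in the second (`y`) variable. -/
def dy (g : ℝ × ℝ → Fin 4 → ℝ) : ℝ × ℝ → Fin 4 → ℝ := fun p => fderiv ℝ g p (0, 1)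

/-- Product rule along a direction for a bilinear form on a finite-dimensional space. -/
theorem fderiv_bilin_apply {E : Type*} [NormedAddCommGroup E] [NormedSpace ℝ E]
    (B : (Fin 4 → ℝ) →ₗ[ℝ] (Fin 4 → ℝ) →ₗ[ℝ] ℝ) {g h : E → Fin 4 → ℝ} {p : E}
    (hg : DifferentiableAt ℝ g p) (hh : DifferentiableAt ℝ h p) (v : E) :
    fderiv ℝ (fun q => B (g q) (h q)) p v
      = B (fderiv ℝ g p v) (h p) + B (g p) (fderiv ℝ h p v) := by
  have H := (B.toContinuousBilinearMap).hasFDerivAt_of_bilinear hg.hasFDerivAt hh.hasFDerivAt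
  have H' : fderiv ℝ (fun q => B (g q) (h q)) p = _ := H.fderiv
  rw [H']
  simp [add_comm]

theorem dot4_eq (a b : Fin 4 → ℝ) :
    dot4 a b = a 0 * b 0 + a 1 * b 1 + a 2 * b 2 + a 3 * b 3 := by
  simp [dot4, Fin.sum_univ_four]

theorem dot4_comm (a b : Fin 4 → ℝ) : dot4 a b = dot4 b a := by
  simp only [dot4, mul_comm]

theorem dot4_self_ne_zero {a : Fin 4 → ℝ} (ha : a ≠ 0) : dot4 a a ≠ 0 := by
  change a ⬝ᵥ a ≠ 0
  simpa [dotProduct_self_eq_zero] using ha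

/-- The Euclidean pairing as a bilinear form. -/
def dotBilin : (Fin 4 → ℝ) →ₗ[ℝ] (Fin 4 → ℝ) →ₗ[ℝ] ℝ :=
  LinearMap.mk₂ ℝ dot4
    (by intros; simp only [dot4_eq, Pi.add_apply]; ring)
    (by intros; simp only [dot4_eq, Pi.smul_apply, smul_eq_mul]; ring)
    (by intros; simp only [dot4_eq, Pi.add_apply]; ring)
    (by intros; simp only [dot4_eq, Pi.smul_apply, smul_eq_mul]; ring)

/-- The coordinate `⟨w, a⟩⟨z, b⟩ - ⟨z, a⟩⟨w, b⟩` of `a ∧ b` as a bilinear form in `a, b`. -/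
def wedgeBilin (w z : Fin 4 → ℝ) : (Fin 4 → ℝ) →ₗ[ℝ] (Fin 4 → ℝ) →ₗ[ℝ] ℝ :=
  LinearMap.mk₂ ℝ (fun a b => dot4 w a * dot4 z b - dot4 z a * dot4 w b)
    (by intros; simp only [dot4_eq, Pi.add_apply]; ring)
    (by intros; simp only [dot4_eq, Pi.smul_apply, smul_eq_mul]; ring)
    (by intros; simp only [dot4_eq, Pi.add_apply]; ring)
    (by intros; simp only [dot4_eq, Pi.smul_apply, smul_eq_mul]; ring)

theorem det4_eq_detRowAlternating (a b c d : Fin 4 → ℝ) :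
    det4 a b c d = Matrix.detRowAlternating ![a, b, c, d] := rfl

theorem update_row_two {α : Type*} (a b c d x : α) :
    Function.update ![a, b, c, d] 2 x = ![a, b, x, d] := by
  ext i; fin_cases i <;> rfl

theorem update_row_three {α : Type*} (a b c d x : α) :
    Function.update ![a, b, c, d] 3 x = ![a, b, c, x] := by
  ext i; fin_cases i <;> rfl

/-- The determinant with its first two rows fixed as a bilinear form in the last two. -/
def detBilin (w z : Fin 4 → ℝ) : (Fin 4 → ℝ) →ₗ[ℝ] (Fin 4 → ℝ) →ₗ[ℝ] ℝ :=
  LinearMap.mk₂ ℝ (det4 w z)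
    (fun a a' b => by
      simpa only [det4_eq_detRowAlternating, update_row_two, update_row_three] using
        (Matrix.detRowAlternating (R := ℝ)).map_update_add ![w, z, 0, b] 2 a a')
    (fun c a b => by
      simpa only [det4_eq_detRowAlternating, update_row_two, update_row_three] using
        (Matrix.detRowAlternating (R := ℝ)).map_update_smul ![w, z, 0, b] 2 c a)
    (fun a b b' => by
      simpa only [det4_eq_detRowAlternating, update_row_two, update_row_three] using
        (Matrix.detRowAlternating (R := ℝ)).map_update_add ![w, z, a, 0] 3 b b')
    (fun c a b => by
      simpa only [det4_eq_detRowAlternating, update_row_two, update_row_three] using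
        (Matrix.detRowAlternating (R := ℝ)).map_update_smul ![w, z, a, 0] 3 c b)

theorem det4_self_left (w a b : Fin 4 → ℝ) : det4 w a a b = 0 :=
  Matrix.det_zero_of_row_eq (i := 1) (j := 2) (by decide) rfl

theorem det4_self_outer (w a b : Fin 4 → ℝ) : det4 w b a b = 0 :=
  Matrix.det_zero_of_row_eq (i := 1) (j := 3) (by decide) rfl

theorem det4_self_right (w z a : Fin 4 → ℝ) : det4 w z a a = 0 :=
  Matrix.det_zero_of_row_eq (i := 2) (j := 3) (by decide) rfl

/-- If `a ∧ b` is a multiple of `⋆(m ∧ n)`, `a ≠ 0`, and `k` is one of `m, n`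
with `⟨a, k⟩ = 0`, then `⟨b, k⟩ = 0`. -/
theorem dot4_eq_zero_of_wedge {a b m n k : Fin 4 → ℝ} {c : ℝ} (ha : a ≠ 0)
    (h : ∀ w z, dot4 w a * dot4 z b - dot4 z a * dot4 w b = c * det4 w z m n)
    (hk : k = m ∨ k = n) (hak : dot4 a k = 0) : dot4 b k = 0 := by
  have h1 := h a k
  have h2 : det4 a k m n = 0 := by
    rcases hk with rfl | rfl
    · exact det4_self_left _ _ _
    · exact det4_self_outer _ _ _
  rw [h2, dot4_comm k a, hak, dot4_comm k b] at h1
  simpa [dot4_self_ne_zero ha] using h1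

theorem lelieuvre_direction {E : Type*} [NormedAddCommGroup E] [NormedSpace ℝ E]
    {f ν f₁ ν₁ f₂ ν₂ : E → Fin 4 → ℝ} (v : E) (c : ℝ)
    (hf : Differentiable ℝ f) (hν : Differentiable ℝ ν)
    (hf₁ : Differentiable ℝ f₁) (hν₁ : Differentiable ℝ ν₁)
    (ef₁ : ∀ p, fderiv ℝ f p v = f₁ p) (eν₁ : ∀ p, fderiv ℝ ν p v = ν₁ p)
    (ef₂ : ∀ p, fderiv ℝ f₁ p v = f₂ p) (eν₂ : ∀ p, fderiv ℝ ν₁ p v = ν₂ p)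
    (hpair : ∀ p, dot4 (f p) (ν p) = 0)
    (hL : ∀ p w z, dot4 w (f p) * dot4 z (f₁ p) - dot4 z (f p) * dot4 w (f₁ p)
      = c * det4 w z (ν p) (ν₁ p))
    (hf0 : ∀ p, f p ≠ 0) (p : E) :
    dot4 (f₁ p) (ν p) = 0 ∧ dot4 (f p) (ν₁ p) = 0 ∧ dot4 (f₁ p) (ν₁ p) = 0 ∧
      dot4 (f₂ p) (ν p) = 0 ∧ dot4 (f p) (ν₂ p) = 0 ∧ dot4 (f₂ p) (ν₂ p) = 0 := by
  have product_zero {g h : E → Fin 4 → ℝ} (hg : Differentiable ℝ g) (hh : Differentiable ℝ h)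
      (hz : ∀ q, dot4 (g q) (h q) = 0) (q : E) :
      dot4 (fderiv ℝ g q v) (h q) + dot4 (g q) (fderiv ℝ h q v) = 0 := by
    have H := fderiv_bilin_apply dotBilin (hg q) (hh q) v
    simpa [dotBilin, hz, eq_comm] using H
  have h10 (q : E) : dot4 (f₁ q) (ν q) = 0 :=
    dot4_eq_zero_of_wedge (hf0 q) (hL q) (.inl rfl) (hpair q)
  have h01 (q : E) : dot4 (f q) (ν₁ q) = 0 := by
    simpa [ef₁, eν₁, h10] using product_zero hf hν hpair q
  have h11 (q : E) : dot4 (f₁ q) (ν₁ q) = 0 :=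
    dot4_eq_zero_of_wedge (hf0 q) (hL q) (.inr rfl) (h01 q)
  have h20 : dot4 (f₂ p) (ν p) = 0 := by
    simpa [ef₂, eν₁, h11] using product_zero hf₁ hν h10 p
  have h02 : dot4 (f p) (ν₂ p) = 0 := by
    simpa [ef₁, eν₂, h11] using product_zero hf hν₁ h01 p
  have hL₂ (w z : Fin 4 → ℝ) :
      dot4 w (f p) * dot4 z (f₂ p) - dot4 z (f p) * dot4 w (f₂ p)
        = c * det4 w z (ν p) (ν₂ p) := by
    have H := fderiv_bilin_apply (wedgeBilin w z) (hf p) (hf₁ p) v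
    have K := fderiv_bilin_apply (c • detBilin w z) (hν p) (hν₁ p) v
    have e : (fun q => wedgeBilin w z (f q) (f₁ q))
        = fun q => (c • detBilin w z) (ν q) (ν₁ q) := funext fun q => hL q w z
    rw [e, K] at H
    simp only [ef₁, ef₂, eν₁, eν₂, wedgeBilin, detBilin, LinearMap.smul_apply,
      LinearMap.mk₂_apply, smul_eq_mul, det4_self_right] at H
    linarith
  exact ⟨h10 p, h01 p, h11 p, h20, h02,
    dot4_eq_zero_of_wedge (hf0 p) hL₂ (.inr rfl) h02⟩

theorem stmt0 (f ν : ℝ × ℝ → Fin 4 → ℝ)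
    (hsf : ContDiff ℝ (⊤ : ℕ∞) f) (hsν : ContDiff ℝ (⊤ : ℕ∞) ν)
    (hpair : ∀ p, dot4 (f p) (ν p) = 0)
    (hLx : ∀ p, ∀ w z : Fin 4 → ℝ,
      dot4 w (f p) * dot4 z (dx f p) - dot4 z (f p) * dot4 w (dx f p)
        = det4 w z (ν p) (dx ν p))
    (hLy : ∀ p, ∀ w z : Fin 4 → ℝ,
      dot4 w (f p) * dot4 z (dy f p) - dot4 z (f p) * dot4 w (dy f p)
        = - det4 w z (ν p) (dy ν p))
    (hf0 : ∀ p, f p ≠ 0) :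
    ∀ p : ℝ × ℝ,
      dot4 (dx f p) (ν p) = 0 ∧ dot4 (f p) (dx ν p) = 0 ∧
      dot4 (dx f p) (dx ν p) = 0 ∧
      dot4 (dx (dx f) p) (ν p) = 0 ∧ dot4 (f p) (dx (dx ν) p) = 0 ∧
      dot4 (dx (dx f) p) (dx (dx ν) p) = 0 ∧
      dot4 (dy f p) (ν p) = 0 ∧ dot4 (f p) (dy ν p) = 0 ∧
      dot4 (dy f p) (dy ν p) = 0 ∧
      dot4 (dy (dy f) p) (ν p) = 0 ∧ dot4 (f p) (dy (dy ν) p) = 0 ∧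
      dot4 (dy (dy f) p) (dy (dy ν) p) = 0 := by
  have hd {g : ℝ × ℝ → Fin 4 → ℝ} (hg : ContDiff ℝ (⊤ : ℕ∞) g) : Differentiable ℝ g :=
    hg.differentiable (by simp)
  have hd' {g : ℝ × ℝ → Fin 4 → ℝ} (hg : ContDiff ℝ (⊤ : ℕ∞) g) (v : ℝ × ℝ) :
      Differentiable ℝ fun p => fderiv ℝ g p v :=
    hd ((hg.fderiv_right (by simp)).clm_apply contDiff_const)
  intro p
  obtain ⟨x1, x2, x3, x4, x5, x6⟩ := lelieuvre_direction (f₁ := dx f) (ν₁ := dx ν)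
    (f₂ := dx (dx f)) (ν₂ := dx (dx ν)) (1, 0) 1 (hd hsf) (hd hsν) (hd' hsf _) (hd' hsν _)
    (fun _ => rfl) (fun _ => rfl) (fun _ => rfl) (fun _ => rfl) hpair
    (fun q w z => by rw [hLx, one_mul]) hf0 p
  have y := lelieuvre_direction (f₁ := dy f) (ν₁ := dy ν)
    (f₂ := dy (dy f)) (ν₂ := dy (dy ν)) (0, 1) (-1) (hd hsf) (hd hsν) (hd' hsf _) (hd' hsν _)
    (fun _ => rfl) (fun _ => rfl) (fun _ => rfl) (fun _ => rfl) hpair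
    (fun q w z => by rw [hLy, neg_one_mul]) hf0 p
  exact ⟨x1, x2, x3, x4, x5, x6, y⟩
end
end

section
/- Under the projective Lelieuvre relations in asymptotic coordinates, the full determinants are invariant: at every point p ∈ ℝ², det(f,f_x,f_y,f_{xy}) = det(ν,ν_x,ν_y,ν_{xy}), det(f,f_x,f_{xx},f_{xxx}) = det(ν,ν_x,ν_{xx},ν_{xxx}), and det(f,f_y,f_{yy},f_{yyy}) = det(ν,ν_y,ν_{yy},ν_{yyy}). -/
noncomputable section

/-- Coordinate expansion of `det4`. -/
theorem det4_eq (a b c d : Fin 4 → ℝ) :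
    det4 a b c d =
      (a 0 * b 1 - a 1 * b 0) * (c 2 * d 3 - c 3 * d 2)
        - (a 0 * b 2 - a 2 * b 0) * (c 1 * d 3 - c 3 * d 1)
        + (a 0 * b 3 - a 3 * b 0) * (c 1 * d 2 - c 2 * d 1)
        + (a 1 * b 2 - a 2 * b 1) * (c 0 * d 3 - c 3 * d 0)
        - (a 1 * b 3 - a 3 * b 1) * (c 0 * d 2 - c 2 * d 0)
        + (a 2 * b 3 - a 3 * b 2) * (c 0 * d 1 - c 1 * d 0) := by
  simp [det4, Matrix.det_succ_row_zero, Fin.sum_univ_succ, Fin.succAbove]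
  ring

/-- The pairing of `w ∧ z` with `a ∧ b`. -/
def wedgePairing (w z a b : Fin 4 → ℝ) : ℝ :=
  dot4 w a * dot4 z b - dot4 z a * dot4 w b

/-- `wedgePairing w z` as a bilinear map. -/
def wedgePairingBilin (w z : Fin 4 → ℝ) : (Fin 4 → ℝ) →ₗ[ℝ] (Fin 4 → ℝ) →ₗ[ℝ] ℝ :=
  LinearMap.mk₂ ℝ (wedgePairing w z)
    (fun _ _ _ => by simp [wedgePairing, dot4, Fin.sum_univ_four]; ring)
    (fun _ _ _ => by simp [wedgePairing, dot4, Fin.sum_univ_four]; ring)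
    (fun _ _ _ => by simp [wedgePairing, dot4, Fin.sum_univ_four]; ring)
    (fun _ _ _ => by simp [wedgePairing, dot4, Fin.sum_univ_four]; ring)

/-- `det4 w z` as a bilinear map. -/
def det4Bilin (w z : Fin 4 → ℝ) : (Fin 4 → ℝ) →ₗ[ℝ] (Fin 4 → ℝ) →ₗ[ℝ] ℝ :=
  LinearMap.mk₂ ℝ (det4 w z)
    (fun _ _ _ => by simp [det4_eq]; ring)
    (fun _ _ _ => by simp [det4_eq]; ring)
    (fun _ _ _ => by simp [det4_eq]; ring)
    (fun _ _ _ => by simp [det4_eq]; ring)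

/-- Leibniz rule for a bilinear form on `ℝ⁴`. -/
theorem fderiv_bilin_apply_s4 (B : (Fin 4 → ℝ) →ₗ[ℝ] (Fin 4 → ℝ) →ₗ[ℝ] ℝ)
    {a b : ℝ × ℝ → Fin 4 → ℝ} (ha : Differentiable ℝ a) (hb : Differentiable ℝ b)
    (p v : ℝ × ℝ) :
    fderiv ℝ (fun q => B (a q) (b q)) p v
      = B (a p) (fderiv ℝ b p v) + B (fderiv ℝ a p v) (b p) := by
  have h := ContinuousLinearMap.hasFDerivAt_of_bilinear B.toContinuousBilinearMap
    (ha p).hasFDerivAt (hb p).hasFDerivAt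
  have h' : HasFDerivAt (fun q => B (a q) (b q)) _ p := h
  rw [h'.fderiv]
  simp

/-- Directional differentiation of a duality relation `a ∧ b = s ⋆ (c ∧ d)`. -/
theorem wedgePairing_fderiv {a b c d : ℝ × ℝ → Fin 4 → ℝ} {s : ℝ}
    (ha : Differentiable ℝ a) (hb : Differentiable ℝ b)
    (hc : Differentiable ℝ c) (hd : Differentiable ℝ d)
    (h : ∀ p w z, wedgePairing w z (a p) (b p) = s * det4 w z (c p) (d p))
    (v p : ℝ × ℝ) (w z : Fin 4 → ℝ) :
    wedgePairing w z (fderiv ℝ a p v) (b p) + wedgePairing w z (a p) (fderiv ℝ b p v)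
      = s * (det4 w z (fderiv ℝ c p v) (d p) + det4 w z (c p) (fderiv ℝ d p v)) := by
  have h₁ := fderiv_bilin_apply_s4 (wedgePairingBilin w z) ha hb p v
  have h₂ := fderiv_bilin_apply_s4 (s • det4Bilin w z) hc hd p v
  have h₃ : (fun q => wedgePairingBilin w z (a q) (b q))
      = fun q => (s • det4Bilin w z) (c q) (d q) := funext fun q => h q w z
  rw [h₃, h₂] at h₁
  simp only [LinearMap.smul_apply, wedgePairingBilin, det4Bilin, LinearMap.mk₂_apply,
    smul_eq_mul] at h₁
  linarith

/-- If `a ∧ b + c ∧ d = ± ⋆ (a' ∧ b' + c' ∧ d')`, then taking exterior squares shows that the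
determinants of the two quadruples agree. -/
theorem det4_eq_of_wedgePairing {a b c d a' b' c' d' : Fin 4 → ℝ} {s : ℝ} (hs : s * s = 1)
    (h : ∀ w z, wedgePairing w z a b + wedgePairing w z c d
      = s * (det4 w z a' b' + det4 w z c' d')) :
    det4 a b c d = det4 a' b' c' d' := by
  have pfaffian : ∀ a b c d : Fin 4 → ℝ, det4 a b c d =
      (a 0 * b 1 - a 1 * b 0 + (c 0 * d 1 - c 1 * d 0))
          * (a 2 * b 3 - a 3 * b 2 + (c 2 * d 3 - c 3 * d 2))
        - (a 0 * b 2 - a 2 * b 0 + (c 0 * d 2 - c 2 * d 0))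
          * (a 1 * b 3 - a 3 * b 1 + (c 1 * d 3 - c 3 * d 1))
        + (a 0 * b 3 - a 3 * b 0 + (c 0 * d 3 - c 3 * d 0))
          * (a 1 * b 2 - a 2 * b 1 + (c 1 * d 2 - c 2 * d 1)) := by
    intro a b c d
    rw [det4_eq]
    ring
  have h01 := h (Pi.single 0 1) (Pi.single 1 1)
  have h02 := h (Pi.single 0 1) (Pi.single 2 1)
  have h03 := h (Pi.single 0 1) (Pi.single 3 1)
  have h12 := h (Pi.single 1 1) (Pi.single 2 1)
  have h13 := h (Pi.single 1 1) (Pi.single 3 1)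
  have h23 := h (Pi.single 2 1) (Pi.single 3 1)
  simp [wedgePairing, dot4, det4_eq, Pi.single_apply]
    at h01 h02 h03 h12 h13 h23
  rw [pfaffian a b c d, pfaffian a' b' c' d', h01, h02, h03, h12, h13, h23]
  linear_combination (
      (a' 0 * b' 1 - a' 1 * b' 0 + (c' 0 * d' 1 - c' 1 * d' 0))
          * (a' 2 * b' 3 - a' 3 * b' 2 + (c' 2 * d' 3 - c' 3 * d' 2))
        - (a' 0 * b' 2 - a' 2 * b' 0 + (c' 0 * d' 2 - c' 2 * d' 0))
          * (a' 1 * b' 3 - a' 3 * b' 1 + (c' 1 * d' 3 - c' 3 * d' 1))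
        + (a' 0 * b' 3 - a' 3 * b' 0 + (c' 0 * d' 3 - c' 3 * d' 0))
          * (a' 1 * b' 2 - a' 2 * b' 1 + (c' 1 * d' 2 - c' 2 * d' 1))) * hs

/-- A directional derivative of a smooth map is smooth. -/
theorem contDiff_fderiv_apply_const {g : ℝ × ℝ → Fin 4 → ℝ} (hg : ContDiff ℝ (⊤ : ℕ∞) g)
    (v : ℝ × ℝ) : ContDiff ℝ (⊤ : ℕ∞) (fun p => fderiv ℝ g p v) :=
  (hg.fderiv_right (m := (⊤ : ℕ∞)) le_rfl).clm_apply contDiff_const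

/-- Invariance of the determinant of the third-order jet in a direction `v` along which
`f ∧ ∂ᵥf = ± ⋆ (ν ∧ ∂ᵥν)`. -/
theorem det4_jet_eq {f ν : ℝ × ℝ → Fin 4 → ℝ} (hsf : ContDiff ℝ (⊤ : ℕ∞) f)
    (hsν : ContDiff ℝ (⊤ : ℕ∞) ν) (v : ℝ × ℝ) {D : (ℝ × ℝ → Fin 4 → ℝ) → ℝ × ℝ → Fin 4 → ℝ}
    (hD : ∀ g p, D g p = fderiv ℝ g p v) {s : ℝ} (hs : s * s = 1)
    (h : ∀ p w z, wedgePairing w z (f p) (D f p) = s * det4 w z (ν p) (D ν p)) (p : ℝ × ℝ) :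
    det4 (f p) (D f p) (D (D f) p) (D (D (D f)) p)
      = det4 (ν p) (D ν p) (D (D ν) p) (D (D (D ν)) p) := by
  have smooth : ∀ {g}, ContDiff ℝ (⊤ : ℕ∞) g → ContDiff ℝ (⊤ : ℕ∞) (D g) := fun {g} hg => by
    rw [show D g = fun p => fderiv ℝ g p v from funext (hD g)]
    exact contDiff_fderiv_apply_const hg v
  have diff : ∀ {g : ℝ × ℝ → Fin 4 → ℝ}, ContDiff ℝ (⊤ : ℕ∞) g → Differentiable ℝ g :=
    fun hg => hg.differentiable (by simp)
  have h₁ : ∀ p w z, wedgePairing w z (f p) (D (D f) p) = s * det4 w z (ν p) (D (D ν) p) := by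
    intro p w z
    have := wedgePairing_fderiv (diff hsf) (diff (smooth hsf)) (diff hsν) (diff (smooth hsν))
      h v p w z
    simp only [← hD] at this
    have e₁ : ∀ a, wedgePairing w z a a = 0 := fun a => by unfold wedgePairing; ring
    have e₂ : ∀ a, det4 w z a a = 0 := fun a => by rw [det4_eq]; ring
    simpa only [e₁, e₂, zero_add] using this
  have h₂ := wedgePairing_fderiv (diff hsf) (diff (smooth (smooth hsf))) (diff hsν)
    (diff (smooth (smooth hsν))) h₁ v p
  simp only [← hD] at h₂
  have rot : ∀ a b c d, det4 b c a d = det4 a b c d := fun a b c d => by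
    rw [det4_eq, det4_eq]; ring
  rw [← rot, ← rot (ν p)]
  exact det4_eq_of_wedgePairing hs h₂

theorem stmt4 (f ν : ℝ × ℝ → Fin 4 → ℝ)
    (hsf : ContDiff ℝ (⊤ : ℕ∞) f) (hsν : ContDiff ℝ (⊤ : ℕ∞) ν)
    (hpair : ∀ p, dot4 (f p) (ν p) = 0)
    (hLx : ∀ p, ∀ w z : Fin 4 → ℝ,
      dot4 w (f p) * dot4 z (dx f p) - dot4 z (f p) * dot4 w (dx f p)
        = det4 w z (ν p) (dx ν p))
    (hLy : ∀ p, ∀ w z : Fin 4 → ℝ,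
      dot4 w (f p) * dot4 z (dy f p) - dot4 z (f p) * dot4 w (dy f p)
        = - det4 w z (ν p) (dy ν p))
    (hf0 : ∀ p, f p ≠ 0) (hν0 : ∀ p, ν p ≠ 0) :
    ∀ p : ℝ × ℝ,
      det4 (f p) (dx f p) (dy f p) (dy (dx f) p)
        = det4 (ν p) (dx ν p) (dy ν p) (dy (dx ν) p) ∧
      det4 (f p) (dx f p) (dx (dx f) p) (dx (dx (dx f)) p)
        = det4 (ν p) (dx ν p) (dx (dx ν) p) (dx (dx (dx ν)) p) ∧
      det4 (f p) (dy f p) (dy (dy f) p) (dy (dy (dy f)) p)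
        = det4 (ν p) (dy ν p) (dy (dy ν) p) (dy (dy (dy ν)) p) := by
  have hx : ∀ p w z, wedgePairing w z (f p) (dx f p) = 1 * det4 w z (ν p) (dx ν p) :=
    fun p w z => by rw [one_mul]; exact hLx p w z
  have hy : ∀ p w z, wedgePairing w z (f p) (dy f p) = -1 * det4 w z (ν p) (dy ν p) :=
    fun p w z => by rw [neg_one_mul]; exact hLy p w z
  intro p
  refine ⟨?_, det4_jet_eq hsf hsν (1, 0) (fun _ _ => rfl) (by norm_num) hx p,
    det4_jet_eq hsf hsν (0, 1) (fun _ _ => rfl) (by norm_num) hy p⟩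
  have diff : ∀ {g : ℝ × ℝ → Fin 4 → ℝ}, ContDiff ℝ (⊤ : ℕ∞) g → Differentiable ℝ g :=
    fun hg => hg.differentiable (by simp)
  have key := det4_eq_of_wedgePairing (by norm_num) (wedgePairing_fderiv (diff hsf)
    (diff (contDiff_fderiv_apply_const hsf (1, 0))) (diff hsν)
    (diff (contDiff_fderiv_apply_const hsν (1, 0))) hx (0, 1) p)
  have swap : ∀ a b c d, det4 a b c d = -det4 c b a d := fun a b c d => by
    rw [det4_eq, det4_eq]; ring
  rw [swap, swap (ν p)]
  exact congrArg Neg.neg key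
end
end

section
/- Let ν : ℝ² → ℝ⁴ be a C³ map and U₁, V₁, W₁, U₂, V₂, W₂ : ℝ² → ℝ be differentiable functions. If ν_{xx} = U₁ ν_x + V₁ ν_y + W₁ ν identically, then det(ν,ν_x,ν_{xx},ν_{xxx}) = V₁² · det(ν,ν_x,ν_y,ν_{xy}) at every point. If ν_{yy} = U₂ ν_x + V₂ ν_y + W₂ ν identically, then det(ν,ν_y,ν_{yy},ν_{yyy}) = −U₂² · det(ν,ν_x,ν_y,ν_{xy}) at every point. (These are the expressions for the projective invariants V₁² and U₂² in the compatibility conditions of the projective Lelieuvre map.) -/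
noncomputable section

/-- The determinant of `n, a` and two vectors expanded in terms of `n, a, b, m`. -/
theorem det4_expand (n a b m : Fin 4 → ℝ) (u v w α β γ : ℝ) :
    det4 n a (u • a + v • b + w • n) (α • a + β • b + γ • n + v • m)
      = v ^ 2 * det4 n a b m := by
  simp [det4, Matrix.det_succ_row_zero, Fin.sum_univ_succ, Fin.succAbove]
  ring

theorem det4_swap (n a b m : Fin 4 → ℝ) : det4 n b a m = -det4 n a b m := by
  simp [det4, Matrix.det_succ_row_zero, Fin.sum_univ_succ, Fin.succAbove]
  ring

theorem fderiv_smul_add_smul_add_smul {E F : Type*} [NormedAddCommGroup E] [NormedSpace ℝ E]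
    [NormedAddCommGroup F] [NormedSpace ℝ F] {a b n : E → F} {u v w : E → ℝ} {p : E}
    (ha : DifferentiableAt ℝ a p) (hb : DifferentiableAt ℝ b p) (hn : DifferentiableAt ℝ n p)
    (hu : DifferentiableAt ℝ u p) (hv : DifferentiableAt ℝ v p) (hw : DifferentiableAt ℝ w p)
    (e : E) :
    fderiv ℝ (fun q => u q • a q + v q • b q + w q • n q) p e
      = u p • fderiv ℝ a p e + fderiv ℝ u p e • a p
        + (v p • fderiv ℝ b p e + fderiv ℝ v p e • b p)
        + (w p • fderiv ℝ n p e + fderiv ℝ w p e • n p) := by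
  have h := ((hu.hasFDerivAt.smul ha.hasFDerivAt).add (hv.hasFDerivAt.smul hb.hasFDerivAt)).add
    (hw.hasFDerivAt.smul hn.hasFDerivAt)
  have h' : HasFDerivAt (fun q => u q • a q + v q • b q + w q • n q) _ p := h
  rw [h'.fderiv]
  simp

/-- If the second derivative of `n` in the direction `e` is `u • ∂ₑn + v • b + w • n`, then the
determinant of `n` and its first three derivatives along `e` is `v ^ 2 * det (n, ∂ₑn, b, ∂ₑb)`. -/
theorem det4_iterated_derivative {E : Type*} [NormedAddCommGroup E] [NormedSpace ℝ E]
    {n a b c : E → Fin 4 → ℝ} {u v w : E → ℝ} {e : E} {p : E}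
    (hna : fderiv ℝ n p e = a p) (hac : fderiv ℝ a p e = c p)
    (hc : ∀ q, c q = u q • a q + v q • b q + w q • n q)
    (ha : DifferentiableAt ℝ a p) (hb : DifferentiableAt ℝ b p) (hn : DifferentiableAt ℝ n p)
    (hu : DifferentiableAt ℝ u p) (hv : DifferentiableAt ℝ v p) (hw : DifferentiableAt ℝ w p) :
    det4 (n p) (a p) (c p) (fderiv ℝ c p e)
      = v p ^ 2 * det4 (n p) (a p) (b p) (fderiv ℝ b p e) := by
  have key : fderiv ℝ c p e
      = (u p * u p + fderiv ℝ u p e + w p) • a p + (u p * v p + fderiv ℝ v p e) • b p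
        + (u p * w p + fderiv ℝ w p e) • n p + v p • fderiv ℝ b p e := by
    rw [show c = fun q => u q • a q + v q • b q + w q • n q from funext hc,
      fderiv_smul_add_smul_add_smul ha hb hn hu hv hw, hna, hac, hc]
    module
  rw [key, hc, det4_expand]

theorem differentiable_fderiv_apply {E F : Type*} [NormedAddCommGroup E] [NormedSpace ℝ E]
    [NormedAddCommGroup F] [NormedSpace ℝ F] {f : E → F} (hf : ContDiff ℝ 2 f) (e : E) :
    Differentiable ℝ fun p => fderiv ℝ f p e :=
  ((hf.fderiv_right (m := 1) (by norm_num)).differentiable (by norm_num)).clm_apply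
    (differentiable_const e)

theorem fderiv_fderiv_apply_comm {E F : Type*} [NormedAddCommGroup E] [NormedSpace ℝ E]
    [NormedAddCommGroup F] [NormedSpace ℝ F] {f : E → F} (hf : ContDiff ℝ 2 f) (p e e' : E) :
    fderiv ℝ (fun q => fderiv ℝ f q e) p e' = fderiv ℝ (fun q => fderiv ℝ f q e') p e := by
  have hd : DifferentiableAt ℝ (fderiv ℝ f) p :=
    (hf.fderiv_right (m := 1) (by norm_num)).differentiable (by norm_num) p
  have hs : IsSymmSndFDerivAt ℝ f p := hf.contDiffAt.isSymmSndFDerivAt (by simp)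
  rw [fderiv_clm_apply hd (differentiableAt_const e),
    fderiv_clm_apply hd (differentiableAt_const e')]
  simpa using hs.eq e' e

theorem stmt6 (ν : ℝ × ℝ → Fin 4 → ℝ) (U₁ V₁ W₁ U₂ V₂ W₂ : ℝ × ℝ → ℝ)
    (hsν : ContDiff ℝ 3 ν)
    (hU₁ : Differentiable ℝ U₁) (hV₁ : Differentiable ℝ V₁) (hW₁ : Differentiable ℝ W₁)
    (hU₂ : Differentiable ℝ U₂) (hV₂ : Differentiable ℝ V₂) (hW₂ : Differentiable ℝ W₂) :
    ((∀ p, dx (dx ν) p = U₁ p • dx ν p + V₁ p • dy ν p + W₁ p • ν p) →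
      ∀ p : ℝ × ℝ,
        det4 (ν p) (dx ν p) (dx (dx ν) p) (dx (dx (dx ν)) p)
          = (V₁ p) ^ 2 * det4 (ν p) (dx ν p) (dy ν p) (dy (dx ν) p)) ∧
    ((∀ p, dy (dy ν) p = U₂ p • dx ν p + V₂ p • dy ν p + W₂ p • ν p) →
      ∀ p : ℝ × ℝ,
        det4 (ν p) (dy ν p) (dy (dy ν) p) (dy (dy (dy ν)) p)
          = - (U₂ p) ^ 2 * det4 (ν p) (dx ν p) (dy ν p) (dy (dx ν) p)) := by
  have h2 : ContDiff ℝ 2 ν := hsν.of_le (by norm_num)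
  have hν : Differentiable ℝ ν := h2.differentiable (by norm_num)
  have hx : Differentiable ℝ (dx ν) := differentiable_fderiv_apply h2 _
  have hy : Differentiable ℝ (dy ν) := differentiable_fderiv_apply h2 _
  refine ⟨fun h p => ?_, fun h p => ?_⟩
  · have hcomm : dy (dx ν) p = fderiv ℝ (dy ν) p (1, 0) := fderiv_fderiv_apply_comm h2 p _ _
    rw [hcomm]
    exact det4_iterated_derivative rfl rfl h (hx p) (hy p) (hν p) (hU₁ p) (hV₁ p) (hW₁ p)
  · have h' : ∀ q, dy (dy ν) q = V₂ q • dy ν q + U₂ q • dx ν q + W₂ q • ν q := fun q => by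
      rw [h q, add_comm (U₂ q • dx ν q)]
    have hdet : det4 (ν p) (dy ν p) (dy (dy ν) p) (dy (dy (dy ν)) p)
        = U₂ p ^ 2 * det4 (ν p) (dy ν p) (dx ν p) (dy (dx ν) p) :=
      det4_iterated_derivative rfl rfl h' (hy p) (hx p) (hν p) (hV₂ p) (hU₂ p) (hW₂ p)
    rw [hdet, det4_swap, mul_neg, neg_mul]
end
end

section
/- Under the elliptic projective Lelieuvre relations, at every point p ∈ ℝ² one has ⟨f,ν_x⟩ = ⟨f_x,ν⟩ = ⟨f,ν_y⟩ = ⟨f_y,ν⟩ = 0, ⟨f_x,ν_y⟩ = ⟨f_y,ν_x⟩ = 0, ⟨f_{xy},ν⟩ = ⟨f,ν_{xy}⟩ = 0, and ⟨f_x,ν_x⟩ = ⟨f_y,ν_y⟩. -/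
noncomputable section

/-- The Leibniz rule for a pairing that vanishes identically. -/
theorem dot4_fderiv_add_eq_zero {g h : ℝ × ℝ → Fin 4 → ℝ} (hg : Differentiable ℝ g)
    (hh : Differentiable ℝ h) (hgh : ∀ p, dot4 (g p) (h p) = 0) (p v : ℝ × ℝ) :
    dot4 (fderiv ℝ g p v) (h p) + dot4 (g p) (fderiv ℝ h p v) = 0 := by
  have hprod := HasFDerivAt.fun_sum (u := Finset.univ) fun i _ =>
    (hasFDerivAt_pi'.mp (hg p).hasFDerivAt i).mul (hasFDerivAt_pi'.mp (hh p).hasFDerivAt i)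
  have hconst : HasFDerivAt (fun q => ∑ i, g q i * h q i) (0 : ℝ × ℝ →L[ℝ] ℝ) p := by
    rw [show (fun q => ∑ i, g q i * h q i) = fun _ => (0 : ℝ) from funext hgh]
    exact hasFDerivAt_const 0 p
  have key := DFunLike.congr_fun (hprod.unique hconst) v
  simp [Fin.sum_univ_four] at key
  simp only [dot4, Fin.sum_univ_four]
  linarith

theorem differentiable_fderiv_apply_s7 {g : ℝ × ℝ → Fin 4 → ℝ} (hg : ContDiff ℝ (⊤ : ℕ∞) g)
    (v : ℝ × ℝ) : Differentiable ℝ fun p => fderiv ℝ g p v :=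
  ((hg.fderiv_right (m := 1) (by norm_cast)).differentiable one_ne_zero).clm_apply
    (differentiable_const v)

theorem det4_eq_zero_of_second_eq_third (a b c : Fin 4 → ℝ) : det4 a b b c = 0 :=
  Matrix.det_zero_of_row_eq (i := 1) (j := 2) (by decide) rfl

theorem det4_eq_zero_of_second_eq_fourth (a b c : Fin 4 → ℝ) : det4 a b c b = 0 :=
  Matrix.det_zero_of_row_eq (i := 1) (j := 3) (by decide) rfl

theorem det4_swap_second_fourth (a b c d : Fin 4 → ℝ) : det4 a d c b = -det4 a b c d := by
  have h := Matrix.det_permute (Equiv.swap (1 : Fin 4) 3) (Matrix.of ![a, b, c, d])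
  rw [Equiv.Perm.sign_swap (by decide)] at h
  rw [det4, det4, show Matrix.of ![a, d, c, b] =
    (Matrix.of ![a, b, c, d]).submatrix (Equiv.swap (1 : Fin 4) 3) id from ?_, h]
  · simp
  · ext i j
    fin_cases i <;> rfl

theorem stmt7 (f ν : ℝ × ℝ → Fin 4 → ℝ)
    (hsf : ContDiff ℝ (⊤ : ℕ∞) f) (hsν : ContDiff ℝ (⊤ : ℕ∞) ν)
    (hpair : ∀ p, dot4 (f p) (ν p) = 0)
    (hLx : ∀ p, ∀ w z : Fin 4 → ℝ,
      dot4 w (f p) * dot4 z (dx f p) - dot4 z (f p) * dot4 w (dx f p)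
        = - det4 w z (ν p) (dy ν p))
    (hLy : ∀ p, ∀ w z : Fin 4 → ℝ,
      dot4 w (f p) * dot4 z (dy f p) - dot4 z (f p) * dot4 w (dy f p)
        = det4 w z (ν p) (dx ν p))
    (hf0 : ∀ p, f p ≠ 0) :
    ∀ p : ℝ × ℝ,
      dot4 (f p) (dx ν p) = 0 ∧ dot4 (dx f p) (ν p) = 0 ∧
      dot4 (f p) (dy ν p) = 0 ∧ dot4 (dy f p) (ν p) = 0 ∧
      dot4 (dx f p) (dy ν p) = 0 ∧ dot4 (dy f p) (dx ν p) = 0 ∧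
      dot4 (dy (dx f) p) (ν p) = 0 ∧ dot4 (f p) (dy (dx ν) p) = 0 ∧
      dot4 (dx f p) (dx ν p) = dot4 (dy f p) (dy ν p) := by
  have hf := hsf.differentiable (by simp)
  have hν := hsν.differentiable (by simp)
  have hff := fun p => dot4_self_ne_zero (hf0 p)
  have hνf : ∀ p, dot4 (ν p) (f p) = 0 := fun p => by rw [dot4_comm, hpair]
  have hfxν : ∀ p, dot4 (dx f p) (ν p) = 0 := fun p => by
    have h := hLx p (f p) (ν p)
    rw [det4_eq_zero_of_second_eq_third, hνf, zero_mul, sub_zero, neg_zero] at h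
    rw [dot4_comm]
    exact (mul_eq_zero.mp h).resolve_left (hff p)
  have hfyν : ∀ p, dot4 (dy f p) (ν p) = 0 := fun p => by
    have h := hLy p (f p) (ν p)
    rw [det4_eq_zero_of_second_eq_third, hνf, zero_mul, sub_zero] at h
    rw [dot4_comm]
    exact (mul_eq_zero.mp h).resolve_left (hff p)
  have hfνx : ∀ p, dot4 (f p) (dx ν p) = 0 := fun p => by
    have h : dot4 (dx f p) (ν p) + dot4 (f p) (dx ν p) = 0 :=
      dot4_fderiv_add_eq_zero hf hν hpair p (1, 0)
    rwa [hfxν, zero_add] at h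
  have hfνy : ∀ p, dot4 (f p) (dy ν p) = 0 := fun p => by
    have h : dot4 (dy f p) (ν p) + dot4 (f p) (dy ν p) = 0 :=
      dot4_fderiv_add_eq_zero hf hν hpair p (0, 1)
    rwa [hfyν, zero_add] at h
  have hfxνy : ∀ p, dot4 (dx f p) (dy ν p) = 0 := fun p => by
    have h := hLx p (f p) (dy ν p)
    rw [det4_eq_zero_of_second_eq_fourth, dot4_comm (dy ν p) (f p), hfνy, zero_mul, sub_zero,
      neg_zero] at h
    rw [dot4_comm]
    exact (mul_eq_zero.mp h).resolve_left (hff p)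
  have hfyνx : ∀ p, dot4 (dy f p) (dx ν p) = 0 := fun p => by
    have h := hLy p (f p) (dx ν p)
    rw [det4_eq_zero_of_second_eq_fourth, dot4_comm (dx ν p) (f p), hfνx, zero_mul, sub_zero] at h
    rw [dot4_comm]
    exact (mul_eq_zero.mp h).resolve_left (hff p)
  intro p
  refine ⟨hfνx p, hfxν p, hfνy p, hfyν p, hfxνy p, hfyνx p, ?_, ?_, ?_⟩
  · have h : dot4 (dy (dx f) p) (ν p) + dot4 (dx f p) (dy ν p) = 0 :=
      dot4_fderiv_add_eq_zero (differentiable_fderiv_apply_s7 hsf (1, 0)) hν hfxν p (0, 1)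
    rwa [hfxνy, add_zero] at h
  · have h : dot4 (dy f p) (dx ν p) + dot4 (f p) (dy (dx ν) p) = 0 :=
      dot4_fderiv_add_eq_zero hf (differentiable_fderiv_apply_s7 hsν (1, 0)) hfνx p (0, 1)
    rwa [hfyνx, zero_add] at h
  · have h₁ := hLx p (f p) (dx ν p)
    have h₂ := hLy p (f p) (dy ν p)
    rw [dot4_comm (dx ν p) (f p), hfνx, zero_mul, sub_zero] at h₁
    rw [dot4_comm (dy ν p) (f p), hfνy, zero_mul, sub_zero, det4_swap_second_fourth] at h₂
    rw [dot4_comm (dx f p), dot4_comm (dy f p)]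
    exact mul_left_cancel₀ (hff p) (h₁.trans h₂.symm)
end
end

section
/- Under the projective Lelieuvre relations for hypersurfaces, for every point p ∈ ℝⁿ and all indices α, γ ∈ {1,…,n} one has f(p)·⟨∂_α f, ∂_γ ν⟩(p) = −A_{αγ}(p)·[ν, ∂₁ν, …, ∂_nν](p) and ⟨∂_α f, ∂_γ ν⟩(p)² = A_{αγ}(p) · det(∂_α∂_γ ν, ν, ∂₁ν, …, ∂_nν)(p). -/
noncomputable section

/-- Euclidean pairing on `ℝᵐ`. -/
def dotn {m : ℕ} (a b : Fin m → ℝ) : ℝ := ∑ i, a i * b i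

/-- Partial derivative in the `α`-th variable of a map `ℝⁿ → ℝ^{n+2}`. -/
def pd {n : ℕ} (α : Fin n) (g : (Fin n → ℝ) → Fin (n + 2) → ℝ) :
    (Fin n → ℝ) → Fin (n + 2) → ℝ :=
  fun p => fderiv ℝ g p (Pi.single α 1)

/-- Determinant of the `(n+2) × (n+2)` matrix whose rows are `w`, `z`, and the `n`
vectors `v 0, …, v (n-1)`. -/
def detWZ {n : ℕ} (w z : Fin (n + 2) → ℝ) (v : Fin n → Fin (n + 2) → ℝ) : ℝ :=
  Matrix.det (Matrix.of (Fin.cons w (Fin.cons z v)))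

/-- Determinant of the `(n+2) × (n+2)` matrix whose rows are `w` and the `n+1`
vectors `v 0, …, v n`. -/
def detW {n : ℕ} (w : Fin (n + 2) → ℝ) (v : Fin (n + 1) → Fin (n + 2) → ℝ) : ℝ :=
  Matrix.det (Matrix.of (Fin.cons w v))

theorem dotn_comm {m : ℕ} (a b : Fin m → ℝ) : dotn a b = dotn b a :=
  Finset.sum_congr rfl fun _ _ => mul_comm _ _

theorem dotn_smul {m : ℕ} (w : Fin m → ℝ) (c : ℝ) (a : Fin m → ℝ) :
    dotn w (c • a) = c * dotn w a := by
  simp only [dotn, Pi.smul_apply, smul_eq_mul, Finset.mul_sum]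
  exact Finset.sum_congr rfl fun _ _ => by ring

theorem ext_dotn {m : ℕ} {a b : Fin m → ℝ} (h : ∀ w, dotn w a = dotn w b) : a = b := by
  funext i
  simpa [dotn, Pi.single_apply] using h (Pi.single i 1)

/-- Leibniz rule for a vanishing pairing. -/
theorem dotn_pd_add_dotn_pd_eq_zero {n : ℕ} {g h : (Fin n → ℝ) → Fin (n + 2) → ℝ}
    (hg : Differentiable ℝ g) (hh : Differentiable ℝ h) (h0 : ∀ p, dotn (g p) (h p) = 0)
    (α : Fin n) (p : Fin n → ℝ) :
    dotn (pd α g p) (h p) + dotn (g p) (pd α h p) = 0 := by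
  have hg' := hasFDerivAt_pi'.1 (hg p).hasFDerivAt
  have hh' := hasFDerivAt_pi'.1 (hh p).hasFDerivAt
  have hsum := HasFDerivAt.fun_sum (u := Finset.univ) fun i _ => (hg' i).mul (hh' i)
  have hzero : HasFDerivAt (fun q => ∑ i, g q i * h q i) (0 : (Fin n → ℝ) →L[ℝ] ℝ) p := by
    have hconst : (fun q => ∑ i, g q i * h q i) = fun _ => (0 : ℝ) := funext h0
    rw [hconst]
    exact hasFDerivAt_const _ _
  have key := DFunLike.congr_fun (hsum.unique hzero) (Pi.single α 1)
  simp only [sum_apply, add_apply,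
    smul_apply, ContinuousLinearMap.comp_apply,
    ContinuousLinearMap.proj_apply, zero_apply, smul_eq_mul] at key
  rw [← key, dotn, dotn, ← Finset.sum_add_distrib]
  exact Finset.sum_congr rfl fun _ _ => by simp only [pd]; ring

theorem differentiable_pd {n : ℕ} {g : (Fin n → ℝ) → Fin (n + 2) → ℝ}
    (hg : ContDiff ℝ (⊤ : ℕ∞) g) (α : Fin n) : Differentiable ℝ (pd α g) := by
  have hfderiv := (contDiff_infty_iff_fderiv.1 hg).2
  exact (hfderiv.differentiable (by simp)).clm_apply (differentiable_const _)

theorem detWZ_eq_zero_of_eq {n : ℕ} {w z : Fin (n + 2) → ℝ} {v : Fin n → Fin (n + 2) → ℝ}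
    (j : Fin n) (h : v j = z) : detWZ w z v = 0 := by
  refine Matrix.det_zero_of_row_eq (i := (0 : Fin (n + 1)).succ) (j := j.succ.succ) ?_ ?_
  · exact fun hij => Fin.succ_ne_zero j (Fin.succ_injective _ hij).symm
  · exact h.symm

/-- Exchanging the second row with one of the later rows changes the sign. -/
theorem detWZ_exchange {n : ℕ} (w x : Fin (n + 2) → ℝ) (v : Fin n → Fin (n + 2) → ℝ)
    (γ : Fin n) :
    detWZ w (v γ) (fun j => if j = γ then x else v j) = -detW w (Fin.cons x v) := by
  have hne : (0 : Fin (n + 1)).succ ≠ γ.succ.succ := fun hij =>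
    Fin.succ_ne_zero γ (Fin.succ_injective _ hij).symm
  have hM : Matrix.of (Fin.cons w (Fin.cons (v γ) fun j => if j = γ then x else v j)) =
      (Matrix.of (Fin.cons w (Fin.cons x v)) : Matrix (Fin (n + 2)) (Fin (n + 2)) ℝ).submatrix
        (Equiv.swap (0 : Fin (n + 1)).succ γ.succ.succ) id := by
    ext i k
    simp only [Matrix.submatrix_apply, Matrix.of_apply, id]
    refine Fin.cases ?_ (fun i => Fin.cases ?_ (fun j => ?_) i) i
    · rw [Equiv.swap_apply_of_ne_of_ne (Fin.succ_ne_zero _).symm (Fin.succ_ne_zero _).symm]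
      rfl
    · rw [Equiv.swap_apply_left]
      rfl
    · by_cases hj : j = γ
      · subst hj
        rw [Equiv.swap_apply_right]
        simp
      · rw [Equiv.swap_apply_of_ne_of_ne
          (fun hij => Fin.succ_ne_zero j (Fin.succ_injective _ hij))
          (fun hij => hj (Fin.succ_injective _ (Fin.succ_injective _ hij)))]
        simp [hj]
  rw [detWZ, detW, hM, Matrix.det_permute, Equiv.Perm.sign_swap hne]
  simp

theorem stmt13 (n : ℕ) (hn : 1 ≤ n)
    (f ν : (Fin n → ℝ) → Fin (n + 2) → ℝ)
    (A : Fin n → Fin n → (Fin n → ℝ) → ℝ)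
    (hsf : ContDiff ℝ (⊤ : ℕ∞) f) (hsν : ContDiff ℝ (⊤ : ℕ∞) ν)
    (hsA : ∀ α β, ContDiff ℝ (⊤ : ℕ∞) (A α β))
    (hpair : ∀ p, dotn (f p) (ν p) = 0)
    (hL : ∀ p, ∀ α : Fin n, ∀ w z : Fin (n + 2) → ℝ,
      dotn w (f p) * dotn z (pd α f p) - dotn z (f p) * dotn w (pd α f p)
        = ∑ β : Fin n, A α β p *
            detWZ w z (fun j => if j = β then ν p else pd j ν p))
    (hf0 : ∀ p, f p ≠ 0)
    (br : (Fin (n + 1) → Fin (n + 2) → ℝ) → Fin (n + 2) → ℝ)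
    (hbr : ∀ (w : Fin (n + 2) → ℝ) (a : Fin (n + 1) → Fin (n + 2) → ℝ),
      dotn w (br a) = detW w a) :
    ∀ p : Fin n → ℝ, ∀ α γ : Fin n,
      dotn (pd α f p) (pd γ ν p) • f p
        = (- A α γ p) • br (Fin.cons (ν p) (fun j => pd j ν p)) ∧
      (dotn (pd α f p) (pd γ ν p)) ^ 2
        = A α γ p * detW (pd α (pd γ ν) p) (Fin.cons (ν p) (fun j => pd j ν p)) := by
  have hdf : Differentiable ℝ f := hsf.differentiable (by simp)
  have hdν : Differentiable ℝ ν := hsν.differentiable (by simp)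
  have hνdf : ∀ p α, dotn (pd α f p) (ν p) = 0 := by
    intro p α
    have h := hL p α (f p) (ν p)
    rw [Finset.sum_eq_zero fun β _ => by rw [detWZ_eq_zero_of_eq β (if_pos rfl), mul_zero],
      dotn_comm (ν p) (f p), hpair, zero_mul, sub_zero] at h
    rw [dotn_comm]
    refine (mul_eq_zero.1 h).resolve_left fun h0 => hf0 p ?_
    exact dotProduct_self_eq_zero.1 h0
  have hfdν : ∀ γ p, dotn (f p) (pd γ ν p) = 0 := fun γ p => by
    simpa only [hνdf, zero_add] using dotn_pd_add_dotn_pd_eq_zero hdf hdν hpair γ p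
  intro p α γ
  have key : ∀ w, dotn w (f p) * dotn (pd α f p) (pd γ ν p) =
      -A α γ p * detW w (Fin.cons (ν p) fun j => pd j ν p) := by
    intro w
    have h := hL p α w (pd γ ν p)
    rw [Finset.sum_eq_single γ
        (fun β _ hβ => by rw [detWZ_eq_zero_of_eq γ (if_neg hβ.symm), mul_zero])
        (fun hγ => absurd (Finset.mem_univ γ) hγ),
      detWZ_exchange w (ν p) (fun j => pd j ν p) γ, dotn_comm (pd γ ν p) (f p), hfdν,
      dotn_comm (pd γ ν p)] at h
    linarith
  constructor
  · refine ext_dotn fun w => ?_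
    rw [dotn_smul, dotn_smul, hbr, ← key w, mul_comm]
  · have h1 := dotn_pd_add_dotn_pd_eq_zero hdf (differentiable_pd hsν γ) (hfdν γ) α p
    have h2 := key (pd α (pd γ ν) p)
    rw [dotn_comm (pd α (pd γ ν) p), eq_neg_of_add_eq_zero_right h1] at h2
    linarith
end
end

section
/- Under the discrete projective Lelieuvre relations, at every point of ℤ² one has: (a) ⟨f₁,ν⟩ = ⟨f,ν₁⟩ = ⟨f₂,ν⟩ = ⟨f,ν₂⟩ = 0; (b) ⟨f₁,ν₂⟩ = ⟨f₂,ν₁⟩; (c) ⟨f₁,ν₂⟩·⟨f,ν₁₂⟩ = −det(ν,ν₁,ν₂,ν₁₂) and ⟨f₁,ν₂⟩·⟨f₁₂,ν⟩ = −det(ν,ν₁,ν₂,ν₁₂) (so ⟨f,ν₁₂⟩ = ⟨f₁₂,ν⟩ wherever ⟨f₁,ν₂⟩ ≠ 0); (d) ⟨f₁,ν₂⟩·⟨f₁₁,ν⟩ = det(ν,ν₁,ν₂,ν₁₁); (e) ⟨f₁,ν₂⟩·⟨f₂₂,ν⟩ = det(ν,ν₁,ν₂,ν₂₂). -/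
noncomputable section

/-- Shift in the first lattice direction. -/
def s1 (g : ℤ × ℤ → Fin 4 → ℝ) : ℤ × ℤ → Fin 4 → ℝ := fun m => g (m.1 + 1, m.2)

/-- Shift in the second lattice direction. -/
def s2 (g : ℤ × ℤ → Fin 4 → ℝ) : ℤ × ℤ → Fin 4 → ℝ := fun m => g (m.1, m.2 + 1)

theorem det4_swap_fst_snd (a b c d : Fin 4 → ℝ) : det4 a b c d = - det4 b a c d := by
  simp [det4, Matrix.det_succ_row_zero, Fin.sum_univ_succ, Fin.succAbove]
  ring

theorem det4_swap_snd_trd (a b c d : Fin 4 → ℝ) : det4 a b c d = - det4 a c b d := by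
  simp [det4, Matrix.det_succ_row_zero, Fin.sum_univ_succ, Fin.succAbove]
  ring

theorem det4_swap_trd_fth (a b c d : Fin 4 → ℝ) : det4 a b c d = - det4 a b d c := by
  simp [det4, Matrix.det_succ_row_zero, Fin.sum_univ_succ, Fin.succAbove]
  ring

theorem det4_self_trd (a b d : Fin 4 → ℝ) : det4 a b a d = 0 :=
  Matrix.det_zero_of_row_eq (i := 0) (j := 2) (by decide) rfl

theorem det4_self_fth (a b c : Fin 4 → ℝ) : det4 a b c a = 0 :=
  Matrix.det_zero_of_row_eq (i := 0) (j := 3) (by decide) rfl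

/-- Along an edge on which `p ∧ q = c • ⋆(u ∧ v)` with `p` nonzero and orthogonal to `u`, the
vector `q` is orthogonal to `u`. -/
theorem dot4_eq_zero_of_wedge_left {p q u v : Fin 4 → ℝ} {c : ℝ}
    (h : ∀ w z, dot4 w p * dot4 z q - dot4 z p * dot4 w q = c * det4 w z u v)
    (hp : p ≠ 0) (hpu : dot4 p u = 0) : dot4 q u = 0 := by
  have := h u p
  rw [det4_self_trd, dot4_comm u p, hpu, dot4_comm u q] at this
  exact (mul_eq_zero.mp (by linarith : dot4 p p * dot4 q u = 0)).resolve_left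
    (dot4_self_ne_zero hp)

/-- Along an edge on which `p ∧ q = c • ⋆(u ∧ v)` with `q` nonzero and orthogonal to `v`, the
vector `p` is orthogonal to `v`. -/
theorem dot4_eq_zero_of_wedge_right {p q u v : Fin 4 → ℝ} {c : ℝ}
    (h : ∀ w z, dot4 w p * dot4 z q - dot4 z p * dot4 w q = c * det4 w z u v)
    (hq : q ≠ 0) (hqv : dot4 q v = 0) : dot4 p v = 0 := by
  have := h v q
  rw [det4_self_fth, dot4_comm v q, hqv, dot4_comm v p] at this
  exact (mul_eq_zero.mp (by linarith : dot4 p v * dot4 q q = 0)).resolve_right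
    (dot4_self_ne_zero hq)

theorem stmt15 (f ν : ℤ × ℤ → Fin 4 → ℝ)
    (hpair : ∀ m, dot4 (f m) (ν m) = 0)
    (hL1 : ∀ m, ∀ w z : Fin 4 → ℝ,
      dot4 w (f m) * dot4 z (s1 f m) - dot4 z (f m) * dot4 w (s1 f m)
        = det4 w z (ν m) (s1 ν m))
    (hL2 : ∀ m, ∀ w z : Fin 4 → ℝ,
      dot4 w (f m) * dot4 z (s2 f m) - dot4 z (f m) * dot4 w (s2 f m)
        = - det4 w z (ν m) (s2 ν m))
    (hf0 : ∀ m, f m ≠ 0) :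
    ∀ m : ℤ × ℤ,
      (dot4 (s1 f m) (ν m) = 0 ∧ dot4 (f m) (s1 ν m) = 0 ∧
        dot4 (s2 f m) (ν m) = 0 ∧ dot4 (f m) (s2 ν m) = 0) ∧
      dot4 (s1 f m) (s2 ν m) = dot4 (s2 f m) (s1 ν m) ∧
      (dot4 (s1 f m) (s2 ν m) * dot4 (f m) (s2 (s1 ν) m)
          = - det4 (ν m) (s1 ν m) (s2 ν m) (s2 (s1 ν) m) ∧
        dot4 (s1 f m) (s2 ν m) * dot4 (s2 (s1 f) m) (ν m)
          = - det4 (ν m) (s1 ν m) (s2 ν m) (s2 (s1 ν) m) ∧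
        (dot4 (s1 f m) (s2 ν m) ≠ 0 →
          dot4 (f m) (s2 (s1 ν) m) = dot4 (s2 (s1 f) m) (ν m))) ∧
      dot4 (s1 f m) (s2 ν m) * dot4 (s1 (s1 f) m) (ν m)
        = det4 (ν m) (s1 ν m) (s2 ν m) (s1 (s1 ν) m) ∧
      dot4 (s1 f m) (s2 ν m) * dot4 (s2 (s2 f) m) (ν m)
        = det4 (ν m) (s1 ν m) (s2 ν m) (s2 (s2 ν) m) := by
  intro m
  have e1 : ∀ m w z, dot4 w (f m) * dot4 z (s1 f m) - dot4 z (f m) * dot4 w (s1 f m)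
      = 1 * det4 w z (ν m) (s1 ν m) := fun m w z => by rw [hL1, one_mul]
  have e2 : ∀ m w z, dot4 w (f m) * dot4 z (s2 f m) - dot4 z (f m) * dot4 w (s2 f m)
      = -1 * det4 w z (ν m) (s2 ν m) := fun m w z => by rw [hL2, neg_one_mul]
  have h1 : dot4 (s1 f m) (ν m) = 0 := dot4_eq_zero_of_wedge_left (e1 m) (hf0 m) (hpair m)
  have h2 : dot4 (f m) (s1 ν m) = 0 :=
    dot4_eq_zero_of_wedge_right (e1 m) (hf0 (m.1 + 1, m.2)) (hpair (m.1 + 1, m.2))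
  have h3 : dot4 (s2 f m) (ν m) = 0 := dot4_eq_zero_of_wedge_left (e2 m) (hf0 m) (hpair m)
  have h4 : dot4 (f m) (s2 ν m) = 0 :=
    dot4_eq_zero_of_wedge_right (e2 m) (hf0 (m.1, m.2 + 1)) (hpair (m.1, m.2 + 1))
  have hA : ∀ z, dot4 (s1 f m) (s2 ν m) * dot4 (f m) z
      = - det4 (ν m) (s1 ν m) (s2 ν m) z := fun z => by
    have := hL1 m (s2 ν m) z
    rw [dot4_comm _ (f m), h4, dot4_comm z (f m), dot4_comm (s2 ν m), det4_swap_snd_trd,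
      det4_swap_trd_fth, det4_swap_fst_snd, det4_swap_snd_trd] at this
    linarith
  have hB : ∀ z, dot4 (s2 f m) (s1 ν m) * dot4 (f m) z
      = - det4 (ν m) (s1 ν m) (s2 ν m) z := fun z => by
    have := hL2 m (s1 ν m) z
    rw [dot4_comm _ (f m), h2, dot4_comm z (f m), dot4_comm (s1 ν m), det4_swap_snd_trd,
      det4_swap_trd_fth, det4_swap_fst_snd] at this
    linarith
  have hb : dot4 (s1 f m) (s2 ν m) = dot4 (s2 f m) (s1 ν m) :=
    mul_right_cancel₀ (dot4_self_ne_zero (hf0 m)) ((hA (f m)).trans (hB (f m)).symm)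
  have hc : dot4 (s1 f m) (s2 ν m) * dot4 (s2 (s1 f) m) (ν m)
      = - det4 (ν m) (s1 ν m) (s2 ν m) (s2 (s1 ν) m) := by
    have : dot4 (s2 ν m) (s1 f m) * dot4 (ν m) (s2 (s1 f) m)
        - dot4 (ν m) (s1 f m) * dot4 (s2 ν m) (s2 (s1 f) m)
        = - det4 (s2 ν m) (ν m) (s1 ν m) (s2 (s1 ν) m) := hL2 (m.1 + 1, m.2) _ _
    rw [dot4_comm (ν m), dot4_comm (ν m), h1, dot4_comm _ (s1 f m), det4_swap_fst_snd,
      det4_swap_snd_trd] at this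
    linarith
  have hd : dot4 (s1 f m) (s2 ν m) * dot4 (s1 (s1 f) m) (ν m)
      = det4 (ν m) (s1 ν m) (s2 ν m) (s1 (s1 ν) m) := by
    have : dot4 (s2 ν m) (s1 f m) * dot4 (ν m) (s1 (s1 f) m)
        - dot4 (ν m) (s1 f m) * dot4 (s2 ν m) (s1 (s1 f) m)
        = det4 (s2 ν m) (ν m) (s1 ν m) (s1 (s1 ν) m) := hL1 (m.1 + 1, m.2) _ _
    rw [dot4_comm (ν m), dot4_comm (ν m), h1, dot4_comm _ (s1 f m), det4_swap_fst_snd,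
      det4_swap_snd_trd] at this
    linarith
  have he : dot4 (s1 f m) (s2 ν m) * dot4 (s2 (s2 f) m) (ν m)
      = det4 (ν m) (s1 ν m) (s2 ν m) (s2 (s2 ν) m) := by
    have : dot4 (s1 ν m) (s2 f m) * dot4 (ν m) (s2 (s2 f) m)
        - dot4 (ν m) (s2 f m) * dot4 (s1 ν m) (s2 (s2 f) m)
        = - det4 (s1 ν m) (ν m) (s2 ν m) (s2 (s2 ν) m) := hL2 (m.1, m.2 + 1) _ _
    rw [dot4_comm (ν m), dot4_comm (ν m), h3, dot4_comm _ (s2 f m), det4_swap_fst_snd] at this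
    rw [hb]
    linarith
  exact ⟨⟨h1, h2, h3, h4⟩, hb, ⟨hA _, hc, fun h => mul_left_cancel₀ h ((hA _).trans hc.symm)⟩,
    hd, he⟩
end
end

section
/- Under the discrete projective Lelieuvre relations, the compatibility conditions hold: at any point m ∈ ℤ², if ν(m) and ν₁(m) are linearly independent and ⟨f₁₂,ν⟩(m) ≠ 0, then ν₁₁(m) lies in the linear span of {ν(m), ν₁(m), ν₁₂(m)}; if ν(m) and ν₂(m) are linearly independent and ⟨f₁₂,ν⟩(m) ≠ 0, then ν₂₂(m) lies in the linear span of {ν(m), ν₂(m), ν₁₂(m)}; dually, if f(m) and f₁(m) are linearly independent and ⟨f,ν₁₂⟩(m) ≠ 0, then f₁₁(m) lies in the linear span of {f(m), f₁(m), f₁₂(m)}, and if f(m) and f₂(m) are linearly independent and ⟨f,ν₁₂⟩(m) ≠ 0, then f₂₂(m) lies in the linear span of {f(m), f₂(m), f₁₂(m)}. -/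
noncomputable section

theorem dot4_add_right (n a b : Fin 4 → ℝ) : dot4 n (a + b) = dot4 n a + dot4 n b :=
  dotProduct_add n a b

theorem dot4_smul_right (c : ℝ) (n a : Fin 4 → ℝ) : dot4 n (c • a) = c * dot4 n a :=
  dotProduct_smul c n a

theorem dot4_self_ne_zero_s17 {n : Fin 4 → ℝ} (hn : n ≠ 0) : dot4 n n ≠ 0 :=
  fun h => hn (dotProduct_self_eq_zero.1 h)

theorem det4_smul_right_self (w z y : Fin 4 → ℝ) (c : ℝ) : det4 w z y (c • y) = 0 := by
  simp [det4, Matrix.det_succ_row_zero, Fin.sum_univ_succ, Fin.succAbove]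
  ring

/-- Four linearly independent vectors of `ℝ⁴` have no common nonzero normal. -/
theorem eq_zero_of_dot4_eq_zero {v : Fin 4 → Fin 4 → ℝ} (hv : LinearIndependent ℝ v)
    {n : Fin 4 → ℝ} (hn : ∀ i, dot4 n (v i) = 0) : n = 0 := by
  by_contra h
  have hmem : n ∈ Submodule.span ℝ (Set.range v) := by
    rw [hv.span_eq_top_of_card_eq_finrank (by simp)]
    trivial
  refine dot4_self_ne_zero_s17 h ?_
  refine Submodule.span_induction (p := fun a _ => dot4 n a = 0) ?_ ?_ ?_ ?_ hmem
  · rintro _ ⟨i, rfl⟩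
    exact hn i
  · exact dotProduct_zero n
  · intro a b _ _ ha hb
    rw [dot4_add_right, ha, hb, add_zero]
  · intro c a _ ha
    rw [dot4_smul_right, ha, mul_zero]

/-- If `x, y` are independent, `x, y, u, v` lie in the hyperplane `n^⊥`, and some `g` is orthogonal
to `y, u` but not to `x`, then `v` is a combination of `x, y, u` unless `u` is a multiple of `y`. -/
theorem mem_span_triple_of_dot4_eq_zero {n g x y u v : Fin 4 → ℝ} (hn : n ≠ 0)
    (hx : dot4 n x = 0) (hy : dot4 n y = 0) (hu : dot4 n u = 0) (hv : dot4 n v = 0)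
    (hgy : dot4 g y = 0) (hgu : dot4 g u = 0) (hgx : dot4 g x ≠ 0)
    (hxy : LinearIndependent ℝ ![x, y]) (huy : ∀ c : ℝ, u ≠ c • y) :
    v ∈ Submodule.span ℝ ({x, y, u} : Set (Fin 4 → ℝ)) := by
  have hu_not : u ∉ Submodule.span ℝ (Set.range ![x, y]) := by
    rw [Matrix.range_cons, Matrix.range_cons, Matrix.range_empty, Set.union_empty,
      Set.singleton_union, Submodule.mem_span_pair]
    rintro ⟨a, b, rfl⟩
    rw [dot4_add_right, dot4_smul_right, dot4_smul_right, hgy, mul_zero, add_zero] at hgu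
    have ha : a = 0 := (mul_eq_zero.1 hgu).resolve_right hgx
    exact huy b (by simp [ha])
  have huxy : LinearIndependent ℝ ![u, x, y] := linearIndependent_finCons.2 ⟨hxy, hu_not⟩
  by_contra hv_not
  have hrange : Set.range ![u, x, y] = {x, y, u} := by
    ext a
    simp only [Matrix.range_cons, Matrix.range_empty, Set.mem_union, Set.mem_singleton_iff,
      Set.mem_insert_iff, Set.mem_empty_iff_false]
    tauto
  have hvuxy : LinearIndependent ℝ ![v, u, x, y] :=
    linearIndependent_finCons.2 ⟨huxy, by rwa [hrange]⟩
  refine hn (eq_zero_of_dot4_eq_zero hvuxy fun i => ?_)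
  fin_cases i
  exacts [hv, hu, hx, hy]

/-- The Lelieuvre relation `a ∧ b = ε ⋆(p ∧ q)` along an edge. -/
def LelieuvreEdge (ε : ℝ) (a b p q : Fin 4 → ℝ) : Prop :=
  ∀ w z : Fin 4 → ℝ, dot4 w a * dot4 z b - dot4 z a * dot4 w b = ε * det4 w z p q

namespace LelieuvreEdge

variable {ε : ℝ} {a b p q x : Fin 4 → ℝ}

theorem dot4_right_left (h : LelieuvreEdge ε a b p q) (ha : a ≠ 0) (hap : dot4 a p = 0) :
    dot4 b p = 0 := by
  have hdet : det4 p a p q = 0 := by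
    apply Matrix.det_zero_of_row_eq (i := 0) (j := 2) (by decide)
    rfl
  have h' := h p a
  rw [hdet, dot4_comm p a, hap, dot4_comm p b] at h'
  have h'' : dot4 a a * dot4 b p = 0 := by linarith
  exact (mul_eq_zero.1 h'').resolve_left (dot4_self_ne_zero_s17 ha)

theorem dot4_left_right (h : LelieuvreEdge ε a b p q) (hb : b ≠ 0) (hbq : dot4 b q = 0) :
    dot4 a q = 0 := by
  have hdet : det4 q b p q = 0 := by
    apply Matrix.det_zero_of_row_eq (i := 0) (j := 3) (by decide)
    rfl
  have h' := h q b
  rw [hdet, dot4_comm q b, hbq, dot4_comm q a] at h'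
  have h'' : dot4 a q * dot4 b b = 0 := by linarith
  exact (mul_eq_zero.1 h'').resolve_right (dot4_self_ne_zero_s17 hb)

theorem dot4_eq_zero_of_eq_smul_normal (h : LelieuvreEdge ε a b p q) (ha : a ≠ 0)
    (hax : dot4 a x = 0) {c : ℝ} (hq : q = c • p) : dot4 b x = 0 := by
  have h' := h x a
  rw [hq, det4_smul_right_self, dot4_comm x a, hax, dot4_comm x b] at h'
  have h'' : dot4 a a * dot4 b x = 0 := by linarith
  exact (mul_eq_zero.1 h'').resolve_left (dot4_self_ne_zero_s17 ha)

theorem dot4_eq_zero_of_eq_smul_point (h : LelieuvreEdge ε a b p q) (hε : ε ≠ 0) (hp : p ≠ 0)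
    (hpx : dot4 p x = 0) {c : ℝ} (hb : b = c • a) : dot4 q x = 0 := by
  have hdet (w z : Fin 4 → ℝ) : det4 w z p q = 0 := by
    have h' := h w z
    rw [hb, dot4_smul_right, dot4_smul_right] at h'
    have h'' : ε * det4 w z p q = 0 := by linarith
    exact (mul_eq_zero.1 h'').resolve_left hε
  have h01 := hdet ![1, 0, 0, 0] ![0, 1, 0, 0]
  have h02 := hdet ![1, 0, 0, 0] ![0, 0, 1, 0]
  have h03 := hdet ![1, 0, 0, 0] ![0, 0, 0, 1]
  have h12 := hdet ![0, 1, 0, 0] ![0, 0, 1, 0]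
  have h13 := hdet ![0, 1, 0, 0] ![0, 0, 0, 1]
  have h23 := hdet ![0, 0, 1, 0] ![0, 0, 0, 1]
  simp [det4, Matrix.det_succ_row_zero, Fin.sum_univ_succ, Fin.succAbove]
    at h01 h02 h03 h12 h13 h23
  obtain ⟨j, hj⟩ := Function.ne_iff.1 hp
  refine (mul_eq_zero.1 (?_ : p j * dot4 q x = 0)).resolve_left hj
  simp only [dot4, Fin.sum_univ_four] at hpx ⊢
  fin_cases j <;> simp <;> grind

end LelieuvreEdge

/-- Compatibility for normals over a path `p, q, r` and an edge `q, s` of the lattice. -/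
theorem LelieuvreEdge.normal_mem_span {ε δ : ℝ} {a b d e p q r s : Fin 4 → ℝ}
    (hab : LelieuvreEdge ε a b p q) (hbd : LelieuvreEdge ε b d q r)
    (hbe : LelieuvreEdge δ b e q s) (ha : a ≠ 0) (hb : b ≠ 0) (hd : d ≠ 0) (he : e ≠ 0)
    (hap : dot4 a p = 0) (hbq : dot4 b q = 0) (hdr : dot4 d r = 0) (hes : dot4 e s = 0)
    (hpq : LinearIndependent ℝ ![p, q]) (hep : dot4 e p ≠ 0) :
    r ∈ Submodule.span ℝ ({p, q, s} : Set (Fin 4 → ℝ)) := by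
  have hbp := hab.dot4_right_left ha hap
  exact mem_span_triple_of_dot4_eq_zero hb hbp hbq (hbe.dot4_left_right he hes)
    (hbd.dot4_left_right hd hdr) (hbe.dot4_right_left hb hbq) hes hep hpq
    fun _ hc => hep (hbe.dot4_eq_zero_of_eq_smul_normal hb hbp hc)

/-- Compatibility for points over a path `a, b, d` and an edge `b, e` of the lattice. -/
theorem LelieuvreEdge.point_mem_span {ε δ : ℝ} {a b d e p q r s : Fin 4 → ℝ}
    (hab : LelieuvreEdge ε a b p q) (hbd : LelieuvreEdge ε b d q r)
    (hbe : LelieuvreEdge δ b e q s) (hδ : δ ≠ 0) (hb : b ≠ 0) (he : e ≠ 0) (hq : q ≠ 0)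
    (hbq : dot4 b q = 0) (hes : dot4 e s = 0)
    (hab_indep : LinearIndependent ℝ ![a, b]) (has : dot4 a s ≠ 0) :
    d ∈ Submodule.span ℝ ({a, b, e} : Set (Fin 4 → ℝ)) := by
  rw [dot4_comm] at has
  have hqa : dot4 q a = 0 := by rw [dot4_comm, hab.dot4_left_right hb hbq]
  refine mem_span_triple_of_dot4_eq_zero hq hqa (by rwa [dot4_comm])
    (by rw [dot4_comm, hbe.dot4_right_left hb hbq])
    (by rw [dot4_comm, hbd.dot4_right_left hb hbq])
    (by rw [dot4_comm, hbe.dot4_left_right he hes]) (by rwa [dot4_comm]) has hab_indep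
    fun _ hc => has (hbe.dot4_eq_zero_of_eq_smul_point hδ hq hqa hc)

theorem stmt17 (f ν : ℤ × ℤ → Fin 4 → ℝ)
    (hpair : ∀ m, dot4 (f m) (ν m) = 0)
    (hL1 : ∀ m, ∀ w z : Fin 4 → ℝ,
      dot4 w (f m) * dot4 z (s1 f m) - dot4 z (f m) * dot4 w (s1 f m)
        = det4 w z (ν m) (s1 ν m))
    (hL2 : ∀ m, ∀ w z : Fin 4 → ℝ,
      dot4 w (f m) * dot4 z (s2 f m) - dot4 z (f m) * dot4 w (s2 f m)
        = - det4 w z (ν m) (s2 ν m))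
    (hf0 : ∀ m, f m ≠ 0) (hν0 : ∀ m, ν m ≠ 0) :
    ∀ m : ℤ × ℤ,
      (LinearIndependent ℝ ![ν m, s1 ν m] → dot4 (s2 (s1 f) m) (ν m) ≠ 0 →
        s1 (s1 ν) m ∈
          Submodule.span ℝ ({ν m, s1 ν m, s2 (s1 ν) m} : Set (Fin 4 → ℝ))) ∧
      (LinearIndependent ℝ ![ν m, s2 ν m] → dot4 (s2 (s1 f) m) (ν m) ≠ 0 →
        s2 (s2 ν) m ∈
          Submodule.span ℝ ({ν m, s2 ν m, s2 (s1 ν) m} : Set (Fin 4 → ℝ))) ∧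
      (LinearIndependent ℝ ![f m, s1 f m] → dot4 (f m) (s2 (s1 ν) m) ≠ 0 →
        s1 (s1 f) m ∈
          Submodule.span ℝ ({f m, s1 f m, s2 (s1 f) m} : Set (Fin 4 → ℝ))) ∧
      (LinearIndependent ℝ ![f m, s2 f m] → dot4 (f m) (s2 (s1 ν) m) ≠ 0 →
        s2 (s2 f) m ∈
          Submodule.span ℝ ({f m, s2 f m, s2 (s1 f) m} : Set (Fin 4 → ℝ))) := by
  intro m
  have e1 (k : ℤ × ℤ) : LelieuvreEdge 1 (f k) (s1 f k) (ν k) (s1 ν k) := fun w z => by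
    rw [hL1, one_mul]
  have e2 (k : ℤ × ℤ) : LelieuvreEdge (-1) (f k) (s2 f k) (ν k) (s2 ν k) := fun w z => by
    rw [hL2, neg_one_mul]
  let m₁ : ℤ × ℤ := (m.1 + 1, m.2)
  let m₂ : ℤ × ℤ := (m.1, m.2 + 1)
  refine ⟨fun hi h => ?_, fun hi h => ?_, fun hi h => ?_, fun hi h => ?_⟩
  · exact (e1 m).normal_mem_span (e1 m₁) (e2 m₁) (hf0 _) (hf0 _) (hf0 _) (hf0 _)
      (hpair _) (hpair _) (hpair _) (hpair _) hi h
  · exact (e2 m).normal_mem_span (e2 m₂) (e1 m₂) (hf0 _) (hf0 _) (hf0 _) (hf0 _)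
      (hpair _) (hpair _) (hpair _) (hpair _) hi h
  · exact (e1 m).point_mem_span (e1 m₁) (e2 m₁) (by norm_num) (hf0 _) (hf0 _) (hν0 _)
      (hpair _) (hpair _) hi h
  · exact (e2 m).point_mem_span (e2 m₂) (e1 m₂) one_ne_zero (hf0 _) (hf0 _) (hν0 _)
      (hpair _) (hpair _) hi h
end
end

section
/- For the discrete affine Lelieuvre map, at every point m ∈ ℤ² one has det(f₁ − f, f₂ − f, f₁₂ − f) = det(ν, ν₁, ν₁₂) · det(ν, ν₁, ν₂). -/
noncomputable section

/-- Euclidean pairing on `ℝ³`. -/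
def dot3 (a b : Fin 3 → ℝ) : ℝ := ∑ i, a i * b i

/-- Determinant of the 3×3 matrix with rows `a, b, c`. -/
def det3 (a b c : Fin 3 → ℝ) : ℝ := Matrix.det (Matrix.of ![a, b, c])

/-- Shift in the first lattice direction. -/
def t1 (g : ℤ × ℤ → Fin 3 → ℝ) : ℤ × ℤ → Fin 3 → ℝ := fun m => g (m.1 + 1, m.2)

/-- Shift in the second lattice direction. -/
def t2 (g : ℤ × ℤ → Fin 3 → ℝ) : ℤ × ℤ → Fin 3 → ℝ := fun m => g (m.1, m.2 + 1)

/-- Backward shift in the first lattice direction. -/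
def t1inv (g : ℤ × ℤ → Fin 3 → ℝ) : ℤ × ℤ → Fin 3 → ℝ := fun m => g (m.1 - 1, m.2)

/-- Backward shift in the second lattice direction. -/
def t2inv (g : ℤ × ℤ → Fin 3 → ℝ) : ℤ × ℤ → Fin 3 → ℝ := fun m => g (m.1, m.2 - 1)

/-- The triple product of `a × b`, `-(a × c)` and `a × b - b × d` factors into two determinants. -/
theorem det3_cross_neg_cross_sub (a b c d : Fin 3 → ℝ) :
    det3 (crossProduct a b) (-crossProduct a c) (crossProduct a b - crossProduct b d)
      = det3 a b d * det3 a b c := by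
  simp [det3, Matrix.det_fin_three, cross_apply]
  ring

theorem stmt18 (f ν : ℤ × ℤ → Fin 3 → ℝ)
    (hL1 : ∀ m, t1 f m - f m = crossProduct (ν m) (t1 ν m))
    (hL2 : ∀ m, t2 f m - f m = - crossProduct (ν m) (t2 ν m)) :
    ∀ m : ℤ × ℤ,
      det3 (t1 f m - f m) (t2 f m - f m) (t2 (t1 f) m - f m)
        = det3 (ν m) (t1 ν m) (t2 (t1 ν) m) * det3 (ν m) (t1 ν m) (t2 ν m) := by
  intro m
  have h12 : t2 (t1 f) m - f m
      = crossProduct (ν m) (t1 ν m) - crossProduct (t1 ν m) (t2 (t1 ν) m) := by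
    have h : t2 (t1 f) m - t1 f m = -crossProduct (t1 ν m) (t2 (t1 ν) m) :=
      hL2 (m.1 + 1, m.2)
    rw [← sub_add_sub_cancel _ (t1 f m), h, hL1 m]
    abel
  rw [h12, hL1 m, hL2 m, det3_cross_neg_cross_sub]
end
end
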